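/- In the BOA setting with fixed learning rate η, if η ℓ_{j,t} ≤ 1/2 for all 1 ≤ j ≤ M and 1 ≤ t ≤ n+1, then Σ_{j=1}^M π_{j,0} exp( −η Σ_{t=1}^{n+1} ℓ_{j,t}(1 + η ℓ_{j,t}) ) ≤ 1. -/

import Mathlib

open Finset

/-- For `x ≥ -1/2`, `exp (x - x²) ≤ 1 + x`. -/
theorem exp_sub_sq_le_one_add {x : ℝ} (hx : -(1 / 2) ≤ x) :
    Real.exp (x - x ^ 2) ≤ 1 + x := by
  rcases le_total 0 x with h0 | h0
  · rw [← Real.le_log_iff_exp_le (by linarith)]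
    refine le_trans ?_ (Real.le_log_one_add_of_nonneg h0)
    rw [le_div_iff₀ (by linarith)]
    nlinarith [pow_nonneg h0 2, pow_nonneg h0 3]
  · obtain ⟨y, rfl⟩ : ∃ y, x = -y := ⟨-x, by ring⟩
    have hy0 : 0 ≤ y := by linarith
    have hy : y ≤ 1 / 2 := by linarith
    have hq := Real.quadratic_le_exp_of_nonneg (x := y + y ^ 2) (by positivity)
    have hpoly : 1 ≤ (1 - y) * (1 + (y + y ^ 2) + (y + y ^ 2) ^ 2 / 2) := by
      have hfactor : 0 ≤ 1 - y - y ^ 2 - y ^ 3 := by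
        have h2 : y ^ 2 ≤ (1 / 2) ^ 2 := by gcongr
        have h3 : y ^ 3 ≤ (1 / 2) ^ 3 := by gcongr
        linarith
      nlinarith [mul_nonneg (pow_nonneg hy0 2) hfactor]
    have hmul : 1 ≤ (1 - y) * Real.exp (y + y ^ 2) :=
      hpoly.trans (mul_le_mul_of_nonneg_left hq (by linarith))
    rw [show -y - (-y) ^ 2 = -(y + y ^ 2) by ring, Real.exp_neg,
      inv_le_iff_one_le_mul₀ (Real.exp_pos _)]
    linarith

/-- The one-step normalizer of BOA is at most `1` when the losses are centered. -/
theorem sum_mul_exp_le_one {ι : Type*} [Fintype ι] (η : ℝ) (p l : ι → ℝ)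
    (hp : ∀ j, 0 ≤ p j) (hsum : ∑ j, p j = 1) (hcenter : ∑ j, p j * l j = 0)
    (hl : ∀ j, η * l j ≤ 1 / 2) :
    ∑ j, p j * Real.exp (-η * l j * (1 + η * l j)) ≤ 1 := by
  calc ∑ j, p j * Real.exp (-η * l j * (1 + η * l j))
      ≤ ∑ j, p j * (1 + -(η * l j)) := by
        refine Finset.sum_le_sum fun j _ => mul_le_mul_of_nonneg_left ?_ (hp j)
        have h := exp_sub_sq_le_one_add (x := -(η * l j)) (by linarith [hl j])
        rwa [show -(η * l j) - (-(η * l j)) ^ 2 = -η * l j * (1 + η * l j) by ring] at h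
    _ = ∑ j, p j - η * ∑ j, p j * l j := by
        rw [Finset.mul_sum, ← Finset.sum_sub_distrib]
        exact Finset.sum_congr rfl fun j _ => by ring
    _ = 1 := by rw [hsum, hcenter]; ring

/-- **Key supermartingale bound for BOA with fixed learning rate.**
In the BOA setting (initial probability vector `π 0`, centered losses
`ℓ j t = a j t - ∑ᵢ π (t-1) i * a i t` and exponential-weight recursion), if
`η * ℓ j t ≤ 1/2` for all `j` and `1 ≤ t ≤ n+1`, then
`∑ⱼ π 0 j * exp(-η ∑_{t=1}^{n+1} ℓ j t (1 + η ℓ j t)) ≤ 1`. -/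
theorem boa_initial_weights_exp_bound (M n : ℕ) (hM : 0 < M) (η : ℝ) (hη : 0 < η)
    (π : ℕ → Fin M → ℝ) (a ℓ : Fin M → ℕ → ℝ)
    (hπ0pos : ∀ j, 0 < π 0 j) (hπ0sum : ∑ j, π 0 j = 1)
    (hℓ : ∀ j, ∀ t ∈ Finset.Icc 1 (n + 1), ℓ j t = a j t - ∑ i, π (t - 1) i * a i t)
    (hπ : ∀ j, ∀ t ∈ Finset.Icc 1 (n + 1),
      π t j = π (t - 1) j * Real.exp (-η * ℓ j t * (1 + η * ℓ j t)) /
        ∑ i, π (t - 1) i * Real.exp (-η * ℓ i t * (1 + η * ℓ i t)))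
    (hbound : ∀ j, ∀ t ∈ Finset.Icc 1 (n + 1), η * ℓ j t ≤ 1 / 2) :
    ∑ j, π 0 j *
      Real.exp (-η * ∑ t ∈ Finset.Icc 1 (n + 1), ℓ j t * (1 + η * ℓ j t)) ≤ 1 := by
  have hne : Nonempty (Fin M) := ⟨⟨0, hM⟩⟩
  have key : ∀ k ≤ n + 1, (∀ j, 0 < π k j) ∧ ∑ j, π k j = 1 ∧ ∃ Z ≤ (1 : ℝ), 0 ≤ Z ∧
      ∀ j, π 0 j * Real.exp (-η * ∑ t ∈ Finset.Icc 1 k, ℓ j t * (1 + η * ℓ j t))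
        = π k j * Z := by
    intro k
    induction k with
    | zero => exact fun _ => ⟨hπ0pos, hπ0sum, 1, le_rfl, zero_le_one, by simp⟩
    | succ k ih =>
      intro hk
      obtain ⟨hpos, hsum, Z, hZ1, hZ0, hZ⟩ := ih (by omega)
      have hmem : k + 1 ∈ Finset.Icc 1 (n + 1) := Finset.mem_Icc.2 ⟨by omega, hk⟩
      have hstep := fun j => hπ j (k + 1) hmem
      have hloss := fun j => hℓ j (k + 1) hmem
      simp only [Nat.add_sub_cancel] at hstep hloss
      have hcenter : ∑ j, π k j * ℓ j (k + 1) = 0 := by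
        simp only [hloss, mul_sub, Finset.sum_sub_distrib, ← Finset.sum_mul, hsum]
        ring
      have hW1 := sum_mul_exp_le_one η (π k) (fun j => ℓ j (k + 1)) (fun j => (hpos j).le)
        hsum hcenter (fun j => hbound j (k + 1) hmem)
      have hW0 : 0 < ∑ j, π k j * Real.exp (-η * ℓ j (k + 1) * (1 + η * ℓ j (k + 1))) :=
        Finset.sum_pos (fun j _ => mul_pos (hpos j) (Real.exp_pos _)) Finset.univ_nonempty
      set W := ∑ j, π k j * Real.exp (-η * ℓ j (k + 1) * (1 + η * ℓ j (k + 1))) with hW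
      refine ⟨fun j => ?_, ?_, Z * W, mul_le_one₀ hZ1 hW0.le hW1, mul_nonneg hZ0 hW0.le,
        fun j => ?_⟩
      · rw [hstep]
        exact div_pos (mul_pos (hpos j) (Real.exp_pos _)) hW0
      · simp only [hstep]
        rw [← Finset.sum_div, ← hW, div_self hW0.ne']
      · rw [Finset.sum_Icc_succ_top (by omega), mul_add, Real.exp_add, ← mul_assoc, hZ, hstep,
          ← mul_assoc (-η)]
        field_simp
  obtain ⟨-, hsum, Z, hZ1, -, hZ⟩ := key (n + 1) le_rfl
  simp only [hZ]
  rw [← Finset.sum_mul, hsum, one_mul]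
  exact hZ1
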